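/- Let k ≥ 1, let a be a radial function on B_1 such that s ↦ s^{N−1} a(s) u(s) φ_k(s) is integrable on (0,1), and let u be a radial Neumann solution of Δu + a u = 0 on B_1. Then the Green-type identity ∫_0^{r_k} s^{N−1} (a(s) − μ_k) u(s) φ_k(s) ds = r_k^{N−1} u(r_k) φ_k′(r_k) holds, where r_k is the smallest zero of φ_k in (0,1). -/

import Mathlib

open MeasureTheory Set Filter

noncomputable section

/-- The measure of the (N-1)-dimensional unit sphere in `ℝ^N`. -/
def omegaN (N : ℕ) : ℝ :=
  N * (volume (Metric.ball (0 : EuclideanSpace ℝ (Fin N)) 1)).toReal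

/-- `u` is a radial Neumann solution of `Δu + a u = 0` on the unit ball of `ℝ^N`,
with explicit derivative function `u'` : `u` is continuous on `[0,1]`, differentiable on
`(0,1]`, satisfies the integrated radial equation
`r^(N-1) u'(r) = -∫_0^r s^(N-1) a(s) u(s) ds` on `(0,1]`, and `u'(1) = 0`. -/
def IsRadialNeumannSolutionDeriv (N : ℕ) (a u u' : ℝ → ℝ) : Prop :=
  ContinuousOn u (Icc 0 1) ∧
  (∀ r ∈ Ioc (0:ℝ) 1, HasDerivAt u (u' r) r) ∧
  (∀ r ∈ Ioc (0:ℝ) 1,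
    r ^ (N - 1) * u' r = - ∫ s in (0:ℝ)..r, s ^ (N - 1) * a s * u s) ∧
  u' 1 = 0

/-- `u` is a radial Neumann solution of `Δu + a u = 0` on the unit ball of `ℝ^N`. -/
def IsRadialNeumannSolution (N : ℕ) (a u : ℝ → ℝ) : Prop :=
  ∃ u' : ℝ → ℝ, IsRadialNeumannSolutionDeriv N a u u'

/-- `u` is not identically zero on `[0,1]`. -/
def NontrivialSol (u : ℝ → ℝ) : Prop := ∃ r ∈ Icc (0:ℝ) 1, u r ≠ 0

/-- `μ ≺ a` : `a(r) ≥ μ` for a.e. `r ∈ (0,1)` and `a(r) > μ` on a set of positive measure. -/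
def Prec (μ : ℝ) (a : ℝ → ℝ) : Prop :=
  (∀ᵐ r ∂(volume.restrict (Ioo (0:ℝ) 1)), μ ≤ a r) ∧
  0 < volume {r ∈ Ioo (0:ℝ) 1 | μ < a r}

/-- A radial function `a` belongs to `L^p(B_1)` (finite `p`). -/
def RadialMemLp (N : ℕ) (p : ℝ) (a : ℝ → ℝ) : Prop :=
  IntegrableOn (fun r => r ^ (N - 1) * |a r| ^ p) (Ioo (0:ℝ) 1)

/-- A radial function `a` belongs to `L^∞(B_1)`. -/
def RadialMemLinfty (a : ℝ → ℝ) : Prop :=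
  ∃ C : ℝ, ∀ᵐ r ∂(volume.restrict (Ioo (0:ℝ) 1)), |a r| ≤ C

/-- The `L^p(B_1)` norm of a radial function (finite `p`):
`(ω_N ∫_0^1 r^(N-1) |a(r)|^p dr)^(1/p)`. -/
def radialLpNorm (N : ℕ) (p : ℝ) (a : ℝ → ℝ) : ℝ :=
  (omegaN N * ∫ r in (0:ℝ)..1, r ^ (N - 1) * |a r| ^ p) ^ (1 / p)

/-- The `L^∞(B_1)` norm of a radial function: essential supremum of `|a|` on `(0,1)`. -/
def radialLinftyNorm (a : ℝ → ℝ) : ℝ :=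
  essSup (fun r => |a r|) (volume.restrict (Ioo (0:ℝ) 1))

/-- The admissible class `Γ_k` at level `μk`: radial measurable `a` with `μk ≺ a`, such that
`Δu + a u = 0` has a nontrivial radial Neumann solution, and `a ∈ L^{N/2}(B_1)` if `N ≥ 3`,
or `a ∈ L^q(B_1)` for some `q ∈ (1,∞]` if `N = 2`. -/
def GammaSet (N : ℕ) (μk : ℝ) (a : ℝ → ℝ) : Prop :=
  Measurable a ∧ Prec μk a ∧
  (∃ u : ℝ → ℝ, IsRadialNeumannSolution N a u ∧ NontrivialSol u) ∧
  (if 3 ≤ N then RadialMemLp N ((N : ℝ) / 2) a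
   else (∃ q : ℝ, 1 < q ∧ RadialMemLp N q a) ∨ RadialMemLinfty a)

/-- The Lyapunov constant `γ_{p,k}` for finite `p`. -/
def gammaLyap (N : ℕ) (μk : ℝ) (p : ℝ) : ℝ :=
  sInf {t : ℝ | ∃ a : ℝ → ℝ, GammaSet N μk a ∧ RadialMemLp N p a ∧
    t = radialLpNorm N p (fun r => a r - μk)}

/-- The Lyapunov constant `γ_{∞,k}`. -/
def gammaLyapInfty (N : ℕ) (μk : ℝ) : ℝ :=
  sInf {t : ℝ | ∃ a : ℝ → ℝ, GammaSet N μk a ∧ RadialMemLinfty a ∧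
    t = radialLinftyNorm (fun r => a r - μk)}

/-- `(μ, φ)` is the `k`-th radial Neumann eigenpair of `-Δ` on `B_1 ⊆ ℝ^N`:
`μ ≥ 0`, `φ` is a nontrivial radial Neumann solution of `Δφ + μ φ = 0` having exactly `k`
zeros in `(0,1)`, all simple, given by `rz k < rz (k-1) < ⋯ < rz 1`. -/
def IsRadialNeumannEigenpair (N k : ℕ) (μ : ℝ) (φ : ℝ → ℝ) (rz : ℕ → ℝ) : Prop :=
  0 ≤ μ ∧
  IsRadialNeumannSolution N (fun _ => μ) φ ∧ NontrivialSol φ ∧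
  (∀ i, 1 ≤ i → i ≤ k → rz i ∈ Ioo (0:ℝ) 1) ∧
  (∀ i j, 1 ≤ i → i < j → j ≤ k → rz j < rz i) ∧
  (∀ x ∈ Ioo (0:ℝ) 1, (φ x = 0 ↔ ∃ i, 1 ≤ i ∧ i ≤ k ∧ x = rz i)) ∧
  (∀ i, 1 ≤ i → i ≤ k → ∃ d : ℝ, d ≠ 0 ∧ HasDerivAt φ d (rz i))

/-- `u` (with derivative `u'`) is a radial `H^1` solution of `Δu + a u = 0` in `B_1`:
continuous on `(0,1]`, differentiable on `(0,1)`, satisfying the integrated radial equation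
between any two radii, with finite radial `H^1` energy. -/
def IsRadialH1Solution (N : ℕ) (a u u' : ℝ → ℝ) : Prop :=
  ContinuousOn u (Ioc 0 1) ∧
  (∀ r ∈ Ioo (0:ℝ) 1, HasDerivAt u (u' r) r) ∧
  (∀ s ∈ Ioo (0:ℝ) 1, ∀ r ∈ Ioo (0:ℝ) 1, s < r →
    r ^ (N - 1) * u' r - s ^ (N - 1) * u' s
      = - ∫ t in s..r, t ^ (N - 1) * a t * u t) ∧
  IntegrableOn (fun r => r ^ (N - 1) * ((u' r) ^ 2 + (u r) ^ 2)) (Ioo (0:ℝ) 1)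

/-- The Sobolev quotient: infimum of `(∫_{B_ρ} |∇w|²) / (∫_{B_ρ} |w|^q)^{2/q}` over nontrivial
`C^1` functions `w : ℝ^N → ℝ` with compact support contained in the ball `B_ρ`. -/
def sobolevQuot (N : ℕ) (q : ℝ) (ρ : ℝ) : ℝ :=
  sInf {t : ℝ | ∃ w : EuclideanSpace ℝ (Fin N) → ℝ,
    ContDiff ℝ 1 w ∧ (∃ x, w x ≠ 0) ∧ tsupport w ⊆ Metric.ball 0 ρ ∧
    t = (∫ x in Metric.ball (0 : EuclideanSpace ℝ (Fin N)) ρ, ‖fderiv ℝ w x‖ ^ 2) /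
        (∫ x in Metric.ball (0 : EuclideanSpace ℝ (Fin N)) ρ, |w x| ^ q) ^ (2 / q)}

open scoped Topology

/-- Integration by parts for the primitive of an integrable function against a `C^1` function. -/
lemma integral_mul_eq_primitive_mul_sub {F v v' : ℝ → ℝ} {c ε b : ℝ} (hcε : c ≤ ε) (hεb : ε ≤ b)
    (hF : IntervalIntegrable F volume c b)
    (hv : ∀ x ∈ Icc ε b, HasDerivAt v (v' x) x) (hv' : ContinuousOn v' (Icc ε b)) :
    ∫ s in ε..b, F s * v s = (∫ s in c..b, F s) * v b - (∫ s in c..ε, F s) * v ε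
      - ∫ s in ε..b, (∫ t in c..s, F t) * v' s := by
  have hcb : c ≤ b := hcε.trans hεb
  have hsub : Icc ε b ⊆ Icc c b := Icc_subset_Icc_left hcε
  have hG : AbsolutelyContinuousOnInterval (fun r => ∫ t in c..r, F t) ε b :=
    (hF.absolutelyContinuousOnInterval_intervalIntegral left_mem_uIcc).mono
      (by rw [uIcc_of_le hεb, uIcc_of_le hcb]; exact hsub)
  have hvac : AbsolutelyContinuousOnInterval v ε b := by
    obtain ⟨C, hC⟩ := isCompact_Icc.exists_bound_of_continuousOn hv'
    have hL : LipschitzOnWith C.toNNReal v (Icc ε b) :=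
      (convex_Icc ε b).lipschitzOnWith_of_nnnorm_hasDerivWithin_le
        (fun x hx => (hv x hx).hasDerivWithinAt) (fun x hx => by
          rw [← NNReal.coe_le_coe, coe_nnnorm]
          exact (hC x hx).trans (Real.le_coe_toNNReal C))
    rw [← uIcc_of_le hεb] at hL
    exact hL.absolutelyContinuousOnInterval
  have key := hvac.integral_mul_deriv_eq_deriv_mul hG
  have hleft : ∫ s in ε..b, F s * v s
      = ∫ s in ε..b, v s * deriv (fun r => ∫ t in c..r, F t) s := by
    refine intervalIntegral.integral_congr_ae ?_
    filter_upwards [hF.ae_hasDerivAt_integral] with x hx hxm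
    rw [uIoc_of_le hεb] at hxm
    have hxm' : x ∈ uIcc c b := by
      rw [uIcc_of_le hcb]
      exact hsub (Ioc_subset_Icc_self hxm)
    rw [(hx hxm' c left_mem_uIcc).deriv, mul_comm]
  have hright : ∫ s in ε..b, (∫ t in c..s, F t) * v' s
      = ∫ s in ε..b, deriv v s * ∫ t in c..s, F t := by
    refine intervalIntegral.integral_congr fun x hx => ?_
    rw [uIcc_of_le hεb] at hx
    rw [(hv x hx).deriv, mul_comm]
  rw [hleft, hright, key]
  ring

/-- The derivative of a solution is continuous away from the origin as long as
`s^(N-1) a(s) u(s)` is integrable. -/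
lemma IsRadialNeumannSolutionDeriv.continuousOn_deriv {N : ℕ} {a u u' : ℝ → ℝ}
    (h : IsRadialNeumannSolutionDeriv N a u u') {r : ℝ} (hr1 : r ≤ 1)
    (hF : IntervalIntegrable (fun s => s ^ (N - 1) * a s * u s) volume 0 r) {ε : ℝ} (hε : 0 < ε)
    (hεr : ε ≤ r) : ContinuousOn u' (Icc ε r) := by
  have h1 : ContinuousOn (fun x => ∫ s in (0:ℝ)..x, s ^ (N - 1) * a s * u s) (Icc ε r) := by
    refine (intervalIntegral.continuousOn_primitive_interval' hF left_mem_uIcc).mono ?_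
    rw [uIcc_of_le (hε.le.trans hεr)]
    exact Icc_subset_Icc_left hε.le
  have h2 : ContinuousOn
      (fun x : ℝ => (- ∫ s in (0:ℝ)..x, s ^ (N - 1) * a s * u s) / x ^ (N - 1)) (Icc ε r) :=
    h1.neg.div (by fun_prop) fun x hx => pow_ne_zero _ (hε.trans_le hx.1).ne'
  refine h2.congr fun x hx => ?_
  have hx0 : 0 < x := hε.trans_le hx.1
  beta_reduce
  rw [← h.2.2.1 x ⟨hx0, hx.2.trans hr1⟩]
  field_simp

/-- Green's identity on an annulus, provided both fluxes are integrable. -/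
lemma IsRadialNeumannSolutionDeriv.green {N : ℕ} {a b u u' v v' : ℝ → ℝ}
    (hu : IsRadialNeumannSolutionDeriv N a u u') (hv : IsRadialNeumannSolutionDeriv N b v v')
    {ε r : ℝ} (hε : 0 < ε) (hεr : ε ≤ r) (hr1 : r ≤ 1)
    (hF : IntervalIntegrable (fun s => s ^ (N - 1) * a s * u s) volume 0 r)
    (hH : IntervalIntegrable (fun s => s ^ (N - 1) * b s * v s) volume 0 r) :
    (∫ s in ε..r, s ^ (N - 1) * a s * u s * v s) - (∫ s in ε..r, s ^ (N - 1) * b s * v s * u s)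
      = (u r * (r ^ (N - 1) * v' r) - r ^ (N - 1) * u' r * v r)
        - (u ε * (ε ^ (N - 1) * v' ε) - ε ^ (N - 1) * u' ε * v ε) := by
  have hmem : ∀ x ∈ Icc ε r, x ∈ Ioc (0:ℝ) 1 := fun x hx => ⟨hε.trans_le hx.1, hx.2.trans hr1⟩
  have e1 := integral_mul_eq_primitive_mul_sub hε.le hεr hF (fun x hx => hv.2.1 x (hmem x hx))
    (hv.continuousOn_deriv hr1 hH hε hεr)
  have e2 := integral_mul_eq_primitive_mul_sub hε.le hεr hH (fun x hx => hu.2.1 x (hmem x hx))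
    (hu.continuousOn_deriv hr1 hF hε hεr)
  have e3 : ∫ s in ε..r, (∫ t in (0:ℝ)..s, t ^ (N - 1) * a t * u t) * v' s
      = ∫ s in ε..r, (∫ t in (0:ℝ)..s, t ^ (N - 1) * b t * v t) * u' s := by
    refine intervalIntegral.integral_congr fun x hx => ?_
    rw [uIcc_of_le hεr] at hx
    have h1 := hu.2.2.1 x (hmem x hx)
    have h2 := hv.2.2.1 x (hmem x hx)
    linear_combination v' x * h1 - u' x * h2
  rw [e1, e2, e3]
  have h1 := hu.2.2.1 r (hmem r ⟨hεr, le_rfl⟩)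
  have h2 := hv.2.2.1 r (hmem r ⟨hεr, le_rfl⟩)
  have h3 := hu.2.2.1 ε (hmem ε ⟨le_rfl, hεr⟩)
  have h4 := hv.2.2.1 ε (hmem ε ⟨le_rfl, hεr⟩)
  rw [h1, h2, h3, h4]
  ring

lemma IsRadialNeumannSolutionDeriv.neg {N : ℕ} {a u u' : ℝ → ℝ}
    (h : IsRadialNeumannSolutionDeriv N a u u') :
    IsRadialNeumannSolutionDeriv N a (fun x => - u x) (fun x => - u' x) := by
  refine ⟨h.1.neg, fun r hr => (h.2.1 r hr).neg, fun r hr => ?_, by simp [h.2.2.2]⟩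
  simp only [mul_neg, intervalIntegral.integral_neg, h.2.2.1 r hr]

lemma IsRadialNeumannSolutionDeriv.pos_zero {N : ℕ} {μ : ℝ} (hμ : 0 ≤ μ) {φ φ' : ℝ → ℝ}
    (h : IsRadialNeumannSolutionDeriv N (fun _ => μ) φ φ') {R : ℝ} (hR : 0 < R) (hR1 : R ≤ 1)
    (hpos : ∀ x ∈ Ioo 0 R, 0 < φ x) : 0 < φ 0 := by
  have hanti : AntitoneOn φ (Icc 0 R) := by
    have hd : ∀ x ∈ Ioo 0 R, HasDerivAt φ (φ' x) x := fun x hx => h.2.1 x ⟨hx.1, hx.2.le.trans hR1⟩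
    refine antitoneOn_of_deriv_nonpos (convex_Icc 0 R) (h.1.mono (Icc_subset_Icc_right hR1)) ?_ ?_
    · rw [interior_Icc]
      exact fun x hx => (hd x hx).differentiableAt.differentiableWithinAt
    · rw [interior_Icc]
      intro x hx
      rw [(hd x hx).deriv]
      have hi : 0 ≤ ∫ s in (0:ℝ)..x, s ^ (N - 1) * μ * φ s := by
        rw [intervalIntegral.integral_of_le hx.1.le]
        refine setIntegral_nonneg measurableSet_Ioc fun s hs => ?_
        exact mul_nonneg (mul_nonneg (pow_nonneg hs.1.le _) hμ)
          (hpos s ⟨hs.1, hs.2.trans_lt hx.2⟩).le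
      have he := h.2.2.1 x ⟨hx.1, hx.2.le.trans hR1⟩
      by_contra! hc
      have := mul_pos (pow_pos hx.1 (N - 1)) hc
      linarith
  exact (hpos (R / 2) ⟨by linarith, by linarith⟩).trans_le
    (hanti ⟨le_rfl, hR.le⟩ ⟨by linarith, by linarith⟩ (by linarith))

lemma IsRadialNeumannSolutionDeriv.ne_zero_zero {N : ℕ} {μ : ℝ} (hμ : 0 ≤ μ) {φ φ' : ℝ → ℝ}
    (h : IsRadialNeumannSolutionDeriv N (fun _ => μ) φ φ') {R : ℝ} (hR : 0 < R) (hR1 : R ≤ 1)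
    (hne : ∀ x ∈ Ioo 0 R, φ x ≠ 0) : φ 0 ≠ 0 := by
  have hsign : (∀ x ∈ Ioo 0 R, 0 < φ x) ∨ ∀ x ∈ Ioo 0 R, 0 < - φ x := by
    by_contra! hc
    obtain ⟨⟨x, hx, hx0⟩, y, hy, hy0⟩ := hc
    have hcont : ContinuousOn φ (Ioo 0 R) :=
      h.1.mono fun z hz => ⟨hz.1.le, hz.2.le.trans hR1⟩
    obtain ⟨z, hz, hz0⟩ := isPreconnected_Ioo.intermediate_value hx hy hcont
      (show (0:ℝ) ∈ Icc (φ x) (φ y) from ⟨hx0, by linarith⟩)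
    exact hne z hz hz0
  rcases hsign with hp | hp
  · exact (h.pos_zero hμ hR hR1 hp).ne'
  · exact neg_ne_zero.mp (ne_of_gt (h.neg.pos_zero hμ hR hR1 hp))

/-- If `u` is differentiable at `R` and `w` vanishes there continuously, then any limit of
`u' w` at `R` from the left is zero. -/
lemma eq_zero_of_tendsto_deriv_mul {u u' w : ℝ → ℝ} {c R L : ℝ} (hc : c < R)
    (hu : ∀ x ∈ Ioc c R, HasDerivAt u (u' x) x) (hw : Tendsto w (𝓝[<] R) (𝓝 0))
    (hL : Tendsto (fun x => u' x * w x) (𝓝[<] R) (𝓝 L)) : L = 0 := by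
  have hex : ∀ r, ∃ ξ, r ∈ Ioo c R → ξ ∈ Ioo r R ∧ u' ξ = (u R - u r) / (R - r) := by
    intro r
    by_cases hr : r ∈ Ioo c R
    · obtain ⟨ξ, hξ, he⟩ := exists_hasDerivAt_eq_slope u u' hr.2
        (fun x hx => (hu x ⟨hr.1.trans_le hx.1, hx.2⟩).continuousAt.continuousWithinAt)
        (fun x hx => hu x ⟨hr.1.trans hx.1, hx.2.le⟩)
      exact ⟨ξ, fun _ => ⟨hξ, he⟩⟩
    · exact ⟨0, fun h => absurd h hr⟩
  choose ξ hξ using hex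
  have hev : ∀ᶠ r in 𝓝[<] R, r ∈ Ioo c R := Ioo_mem_nhdsLT hc
  have hξt : Tendsto ξ (𝓝[<] R) (𝓝[<] R) := by
    refine tendsto_nhdsWithin_iff.mpr ⟨?_, hev.mono fun r hr => (hξ r hr).1.2⟩
    exact tendsto_of_tendsto_of_tendsto_of_le_of_le'
      (tendsto_id.mono_left nhdsWithin_le_nhds) tendsto_const_nhds
      (hev.mono fun r hr => (hξ r hr).1.1.le) (hev.mono fun r hr => (hξ r hr).1.2.le)
  have hslope : Tendsto (fun r => u' (ξ r)) (𝓝[<] R) (𝓝 (u' R)) := by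
    have hs := ((hu R ⟨hc, le_rfl⟩).tendsto_slope).mono_left
      (nhdsWithin_mono R fun x (hx : x < R) => hx.ne)
    refine hs.congr' (hev.mono fun r hr => ?_)
    beta_reduce
    rw [(hξ r hr).2, slope_comm, slope_def_field]
  have h0 := hslope.mul (hw.comp hξt)
  rw [mul_zero] at h0
  exact tendsto_nhds_unique (hL.comp hξt) h0

/-- Green-type identity on the ball `B_{r_k}`: for `k ≥ 1`, a radial `a` with
`s ↦ s^(N-1) a(s) u(s) φ_k(s)` integrable on `(0,1)`, and `u` a radial Neumann solution of
`Δu + a u = 0`, one has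
`∫_0^{r_k} s^(N-1) (a(s) - μ_k) u(s) φ_k(s) ds = r_k^(N-1) u(r_k) φ_k'(r_k)`. -/
theorem stmt8 (N k : ℕ) (hN : 2 ≤ N) (hk1 : 1 ≤ k)
    (μk : ℝ) (φk φk' : ℝ → ℝ) (rz : ℕ → ℝ)
    (hek : IsRadialNeumannEigenpair N k μk φk rz)
    (hφ : IsRadialNeumannSolutionDeriv N (fun _ => μk) φk φk')
    (a : ℝ → ℝ) (hmeas : Measurable a)
    (u : ℝ → ℝ) (hu : IsRadialNeumannSolution N a u)
    (hint : IntegrableOn (fun s => s ^ (N - 1) * a s * u s * φk s) (Ioo (0:ℝ) 1)) :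
    ∫ s in (0:ℝ)..(rz k), s ^ (N - 1) * (a s - μk) * u s * φk s
      = (rz k) ^ (N - 1) * u (rz k) * φk' (rz k) := by
  obtain ⟨hμ, -, -, hmem, hlt, hzero, -⟩ := hek
  obtain ⟨u', hu⟩ := hu
  have hR := hmem k hk1 le_rfl
  have hφR : φk (rz k) = 0 := (hzero _ hR).mpr ⟨k, hk1, le_rfl, rfl⟩
  have hne : ∀ x ∈ Ioo 0 (rz k), φk x ≠ 0 := by
    intro x hx h0
    obtain ⟨i, hi1, hik, rfl⟩ := (hzero x ⟨hx.1, hx.2.trans hR.2⟩).mp h0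
    rcases hik.eq_or_lt with rfl | hik
    · exact lt_irrefl _ hx.2
    · exact lt_asymm hx.2 (hlt i k hi1 hik le_rfl)
  generalize rz k = R at hR hφR hne ⊢
  have hφ0 : φk 0 ≠ 0 := hφ.ne_zero_zero hμ hR.1 hR.2.le hne
  have hu01 : ContinuousOn u (uIcc 0 1) := by rw [uIcc_of_le zero_le_one]; exact hu.1
  have hφ01 : ContinuousOn φk (uIcc 0 1) := by rw [uIcc_of_le zero_le_one]; exact hφ.1
  have hH : IntervalIntegrable (fun s => s ^ (N - 1) * μk * φk s) volume 0 1 :=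
    ContinuousOn.intervalIntegrable (by fun_prop)
  have hHu : IntervalIntegrable (fun s => s ^ (N - 1) * μk * φk s * u s) volume 0 1 :=
    hH.mul_continuousOn hu01
  have hFφ : IntervalIntegrable (fun s => s ^ (N - 1) * a s * u s * φk s) volume 0 1 :=
    (intervalIntegrable_iff_integrableOn_Ioo_of_le zero_le_one).mpr hint
  have hK : IntervalIntegrable (fun s => s ^ (N - 1) * (a s - μk) * u s * φk s) volume 0 1 :=
    (hFφ.sub hHu).congr (fun s _ => by ring)
  have hmono : ∀ {f : ℝ → ℝ} {x y : ℝ}, x ∈ Icc (0:ℝ) 1 → y ∈ Icc (0:ℝ) 1 →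
      IntervalIntegrable f volume 0 1 → IntervalIntegrable f volume x y := by
    intro f x y hx hy hf
    refine hf.mono_set ?_
    rw [uIcc_of_le (zero_le_one' ℝ)]
    exact uIcc_subset_Icc hx hy
  have hFr : ∀ r ∈ Ioo 0 R, IntervalIntegrable (fun s => s ^ (N - 1) * a s * u s) volume 0 r := by
    intro r hr
    have hsub : Icc 0 r ⊆ Icc (0:ℝ) 1 := Icc_subset_Icc_right (hr.2.le.trans hR.2.le)
    have hφne : ∀ s ∈ Icc 0 r, φk s ≠ 0 := by
      intro s hs
      rcases hs.1.eq_or_lt with rfl | h0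
      · exact hφ0
      · exact hne s ⟨h0, hs.2.trans_lt hr.2⟩
    have hinv : ContinuousOn (fun s => (φk s)⁻¹) (uIcc 0 r) := by
      rw [uIcc_of_le hr.1.le]
      exact (hφ.1.mono hsub).inv₀ hφne
    refine ((hmono ⟨le_rfl, zero_le_one⟩ (hsub ⟨hr.1.le, le_rfl⟩) hFφ).mul_continuousOn
      hinv).congr fun s hs => ?_
    rw [uIoc_of_le hr.1.le] at hs
    exact mul_inv_cancel_right₀ (hφne s (Ioc_subset_Icc_self hs)) _
  have hprim : ∀ {f : ℝ → ℝ}, IntervalIntegrable f volume 0 1 →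
      ContinuousOn (fun x => ∫ s in (0:ℝ)..x, f s) (Icc 0 1) := by
    intro f hf
    have := intervalIntegral.continuousOn_primitive_interval' hf left_mem_uIcc
    rwa [uIcc_of_le zero_le_one] at this
  have hgreen : ∀ r ∈ Ioo 0 R, ∀ ε ∈ Ioo 0 r,
      (∫ s in (0:ℝ)..r, s ^ (N - 1) * (a s - μk) * u s * φk s)
        - (∫ s in (0:ℝ)..ε, s ^ (N - 1) * (a s - μk) * u s * φk s)
      = (u r * (r ^ (N - 1) * φk' r) - r ^ (N - 1) * u' r * φk r)
        - (u ε * (ε ^ (N - 1) * φk' ε) - ε ^ (N - 1) * u' ε * φk ε) := by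
    intro r hr ε hε
    have hr1 : r ≤ 1 := hr.2.le.trans hR.2.le
    have hr01 : r ∈ Icc (0:ℝ) 1 := ⟨hr.1.le, hr1⟩
    have hε01 : ε ∈ Icc (0:ℝ) 1 := ⟨hε.1.le, hε.2.le.trans hr1⟩
    have h00 : (0:ℝ) ∈ Icc (0:ℝ) 1 := ⟨le_rfl, zero_le_one⟩
    rw [← hu.green hφ hε.1 hε.2.le hr1 (hFr r hr) (hmono h00 hr01 hH),
      intervalIntegral.integral_interval_sub_left (hmono h00 hr01 hK) (hmono h00 hε01 hK),
      ← intervalIntegral.integral_sub (hmono hε01 hr01 hFφ) (hmono hε01 hr01 hHu)]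
    exact intervalIntegral.integral_congr fun s _ => by ring
  have hgreen0 : ∀ r ∈ Ioo 0 R, ∫ s in (0:ℝ)..r, s ^ (N - 1) * (a s - μk) * u s * φk s
      = u r * (r ^ (N - 1) * φk' r) - r ^ (N - 1) * u' r * φk r := by
    intro r hr
    have hr1 : r ≤ 1 := hr.2.le.trans hR.2.le
    have hev : ∀ᶠ ε in 𝓝[>] (0:ℝ), ε ∈ Ioo 0 r := Ioo_mem_nhdsGT hr.1
    have hle : 𝓝[>] (0:ℝ) ≤ 𝓝[Icc 0 r] 0 := by
      rw [← nhdsWithin_Ioo_eq_nhdsGT hr.1]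
      exact nhdsWithin_mono _ Ioo_subset_Icc_self
    have hlim : ∀ {g : ℝ → ℝ}, ContinuousOn g (Icc 0 r) → Tendsto g (𝓝[>] 0) (𝓝 (g 0)) :=
      fun hg => (hg 0 ⟨le_rfl, hr.1.le⟩).mono_left hle
    have hsub : Icc 0 r ⊆ Icc (0:ℝ) 1 := Icc_subset_Icc_right hr1
    have tK := hlim ((hprim hK).mono hsub)
    have tH := hlim ((hprim hH).mono hsub)
    have tu := hlim (hu.1.mono hsub)
    have tφ := hlim (hφ.1.mono hsub)
    have tF := hlim (g := fun x => ∫ s in (0:ℝ)..x, s ^ (N - 1) * a s * u s) (by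
      have := intervalIntegral.continuousOn_primitive_interval' (hFr r hr) left_mem_uIcc
      rwa [uIcc_of_le hr.1.le] at this)
    have t1 := (tendsto_const_nhds (x := ∫ s in (0:ℝ)..r, s ^ (N - 1) * (a s - μk) * u s * φk s)
      (f := 𝓝[>] (0:ℝ))).sub tK
    have t2 := (tendsto_const_nhds
      (x := u r * (r ^ (N - 1) * φk' r) - r ^ (N - 1) * u' r * φk r)
      (f := 𝓝[>] (0:ℝ))).sub ((tu.mul tH.neg).sub (tF.neg.mul tφ))
    simp only [intervalIntegral.integral_same, neg_zero, mul_zero, zero_mul, sub_zero] at t1 t2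
    refine tendsto_nhds_unique t1 (t2.congr' (hev.mono fun ε hε => ?_))
    have hεm : ε ∈ Ioc (0:ℝ) 1 := ⟨hε.1, hε.2.le.trans hr1⟩
    beta_reduce
    rw [hgreen r hr ε hε, hu.2.2.1 ε hεm, hφ.2.2.1 ε hεm]
  have hev : ∀ᶠ r in 𝓝[<] R, r ∈ Ioo 0 R := Ioo_mem_nhdsLT hR.1
  have hlim : ∀ {g : ℝ → ℝ}, ContinuousOn g (Icc 0 1) → Tendsto g (𝓝[<] R) (𝓝 (g R)) :=
    fun hg => (hg.continuousAt (Icc_mem_nhds hR.1 hR.2)).tendsto.mono_left nhdsWithin_le_nhds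
  have tφ : Tendsto (fun x => x ^ (N - 1) * φk x) (𝓝[<] R) (𝓝 0) := by
    have := hlim (g := fun x => x ^ (N - 1) * φk x) (by have := hφ.1; fun_prop)
    simpa [hφR] using this
  have tL := ((hlim hu.1).mul (hlim (hprim hH)).neg).sub (hlim (hprim hK))
  have hL := eq_zero_of_tendsto_deriv_mul hR.1 (fun x hx => hu.2.1 x ⟨hx.1, hx.2.trans hR.2.le⟩) tφ
    (tL.congr' (hev.mono fun r hr => by
      simp only
      rw [hgreen0 r hr, ← hφ.2.2.1 r ⟨hr.1, hr.2.le.trans hR.2.le⟩]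
      ring))
  rw [← hφ.2.2.1 R ⟨hR.1, hR.2.le⟩] at hL
  linear_combination -hL
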